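/- Let ε > 0 and let (G, w) be an ε-coherent weighted graph. If X ⊆ V(G) with w(X) ≥ 3ε, then there is a component Y of G[X] with w(V(Y)) > w(X) − ε. -/

import Mathlib

open Finset

namespace EHhat

variable {V : Type*}

/-- `c : ZMod n → V` describes a hole (induced cycle of length `n ≥ 4`) in `G`. -/
def IsHole (G : SimpleGraph V) (n : ℕ) (c : ZMod n → V) : Prop :=
  4 ≤ n ∧ Function.Injective c ∧
    ∀ i j : ZMod n, G.Adj (c i) (c j) ↔ (i - j = 1 ∨ j - i = 1)

/-- `G` contains a hole together with a hat: a vertex outside the hole with exactly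
two neighbours on the hole, and these two neighbours are adjacent (consecutive). -/
def HasHoleWithHat (G : SimpleGraph V) : Prop :=
  ∃ (n : ℕ) (c : ZMod n → V) (v : V) (i : ZMod n),
    IsHole G n c ∧ (∀ j, v ≠ c j) ∧ (∀ j, G.Adj v (c j) ↔ (j = i ∨ j = i + 1))

def HoleWithHatFree (G : SimpleGraph V) : Prop := ¬ HasHoleWithHat G

/-- A graph is perfect if chromatic number equals clique number for
every induced subgraph. -/
def IsPerfect [Fintype V] (G : SimpleGraph V) : Prop :=
  ∀ S : Finset V,
    (G.induce (S : Set V)).chromaticNumber = ((G.induce (S : Set V)).cliqueNum : ℕ∞)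

/-- `f` is a good function on `G`: it is nonnegative and sums to at most 1 on
every perfect induced subgraph of `G`. -/
def GoodOn [Fintype V] (G : SimpleGraph V) (f : V → ℝ) : Prop :=
  (∀ v, 0 ≤ f v) ∧
  ∀ S : Finset V, IsPerfect (G.induce (S : Set V)) → ∑ v ∈ S, f v ≤ 1

/-- `G` is `α`-narrow if `∑ v, f v ^ α ≤ 1` for every good function `f` on `G`. -/
def Narrow [Fintype V] (G : SimpleGraph V) (α : ℝ) : Prop :=
  ∀ f : V → ℝ, GoodOn G f → ∑ v, f v ^ α ≤ 1

/-- `(G, f)` is an `α`-critical pair. -/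
def Critical [Fintype V] (G : SimpleGraph V) (f : V → ℝ) (α : ℝ) : Prop :=
  GoodOn G f ∧
  (∀ S : Finset V, S ≠ Finset.univ → Narrow (G.induce (S : Set V)) α) ∧
  1 < ∑ v, f v ^ α

/-- `A` is complete to `B`. -/
def CompleteTo (G : SimpleGraph V) (A B : Set V) : Prop :=
  ∀ a ∈ A, ∀ b ∈ B, G.Adj a b

/-- `A` is anticomplete to `B`. -/
def AnticompleteTo (G : SimpleGraph V) (A B : Set V) : Prop :=
  ∀ a ∈ A, ∀ b ∈ B, ¬ G.Adj a b

/-- The vertex `v` is complete to the set `C`. -/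
def VertCompleteTo (G : SimpleGraph V) (v : V) (C : Set V) : Prop :=
  ∀ c ∈ C, G.Adj v c

/-- The vertex `v` is mixed on `C`: it has both a neighbour and a non-neighbour in `C`. -/
def MixedOn (G : SimpleGraph V) (v : V) (C : Set V) : Prop :=
  (∃ c ∈ C, G.Adj v c) ∧ (∃ c ∈ C, ¬ G.Adj v c)

/-- `X ⊆ V(G)` is connected: `G[X]` is a connected graph. -/
def ConnSet (G : SimpleGraph V) (X : Set V) : Prop :=
  (G.induce X).Connected

/-- `X ⊆ V(G)` is anticonnected: the complement of `G[X]` is a connected graph. -/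
def AnticonnSet (G : SimpleGraph V) (X : Set V) : Prop :=
  ((G.induce X)ᶜ).Connected

/-- The sum of `f` over a set `X` of vertices. -/
noncomputable def setSum [Fintype V] (f : V → ℝ) (X : Set V) : ℝ :=
  ∑ v, X.indicator f v

/-- `w` is a weight function making `(G, w)` a weighted graph. -/
def IsWeight [Fintype V] (w : V → ℝ) : Prop :=
  (∀ v, 0 ≤ w v) ∧ ∑ v, w v = 1

/-- The weighted graph `(G, w)` is `ε`-coherent. -/
def Coherent [Fintype V] (G : SimpleGraph V) (w : V → ℝ) (ε : ℝ) : Prop :=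
  (∀ v, w v < ε) ∧
  (∀ v, setSum w (G.neighborSet v) < ε) ∧
  ∀ A B : Set V, Disjoint A B → AnticompleteTo G A B →
    min (setSum w A) (setSum w B) < ε

/-- `Y` is (the vertex set of) a component of `G[X]`: a maximal connected subset of `X`. -/
def IsCompOf (G : SimpleGraph V) (X Y : Set V) : Prop :=
  Y ⊆ X ∧ ConnSet G Y ∧
  ∀ Z : Set V, Y ⊆ Z → Z ⊆ X → ConnSet G Z → Z = Y

/-- `Y` is the big component of `G[X]` (with respect to the weight `w` and `ε`). -/
def IsBigComp [Fintype V] (G : SimpleGraph V) (w : V → ℝ) (ε : ℝ) (X Y : Set V) : Prop :=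
  IsCompOf G X Y ∧ setSum w X - ε < setSum w Y

/-- `v` is an attachment of `A`: a vertex outside `A` with a neighbour in `A`. -/
def IsAttachment (G : SimpleGraph V) (A : Set V) (v : V) : Prop :=
  v ∉ A ∧ ∃ a ∈ A, G.Adj v a

/-- `(C, D)` is a split of the weighted graph `(G, w)`. -/
def IsSplit [Fintype V] (G : SimpleGraph V) (w : V → ℝ) (ε : ℝ) (C D : Set V) : Prop :=
  Disjoint C D ∧ 2 ≤ C.ncard ∧ ConnSet G C ∧ AnticonnSet G C ∧
  D.Nonempty ∧ D = {v | v ∉ C ∧ ∀ c ∈ C, G.Adj v c} ∧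
  ∀ Y : Set V, IsBigComp G w ε ((C ∪ D)ᶜ) Y → ∀ c ∈ C, ¬ IsAttachment G Y c

/-- A split is optimal if its first part is maximal among splits. -/
def IsOptimalSplit [Fintype V] (G : SimpleGraph V) (w : V → ℝ) (ε : ℝ) (C D : Set V) : Prop :=
  IsSplit G w ε C D ∧ ∀ C' D' : Set V, IsSplit G w ε C' D' → C ⊆ C' → C' = C

/-- `(A, C, D, B)` is a fracture of `(G, w)`: `(C, D)` is an optimal split, `A` is the union
of the components of `G \ (C ∪ D)` with an attachment in `C`, and `B` is the rest. -/
def IsFracture [Fintype V] (G : SimpleGraph V) (w : V → ℝ) (ε : ℝ)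
    (A C D B : Set V) : Prop :=
  IsOptimalSplit G w ε C D ∧
  A = {v | ∃ Y : Set V, IsCompOf G ((C ∪ D)ᶜ) Y ∧ v ∈ Y ∧ ∃ c ∈ C, IsAttachment G Y c} ∧
  B = ((C ∪ D)ᶜ : Set V) \ A

/-- The generating relation for the forcer graph: vertices `0,1,2,3` and `4,5,6,7`
each induce a path, and the two quadruples are complete to each other. -/
def forcerRel (i j : Fin 8) : Prop :=
  (i.val < 4 ∧ 4 ≤ j.val) ∨ j.val = i.val + 1

/-- The forcer graph. -/
def forcer : SimpleGraph (Fin 8) := SimpleGraph.fromRel forcerRel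

def ForcerFree (G : SimpleGraph V) : Prop := IsEmpty (forcer ↪g G)

/-- Given an embedded copy of the forcer via the vertex map `f`, one of its two
constituent paths has all its vertices in `S`. -/
def ConstituentPathIn (f : Fin 8 → V) (S : Set V) : Prop :=
  (∀ i : Fin 8, i.val < 4 → f i ∈ S) ∨ (∀ i : Fin 8, 4 ≤ i.val → f i ∈ S)

/-- `X` is a homogeneous set of `H`. -/
def IsHomogeneousSet {W : Type*} (H : SimpleGraph W) (X : Set W) : Prop :=
  ∀ v ∉ X, (∀ x ∈ X, H.Adj v x) ∨ (∀ x ∈ X, ¬ H.Adj v x)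

/-- `H` is guarded: for each forcer in `H` there is a proper homogeneous set
containing a constituent path of the forcer. -/
def Guarded {W : Type*} (H : SimpleGraph W) : Prop :=
  ∀ f : forcer ↪g H, ∃ X : Set W,
    X ≠ Set.univ ∧ IsHomogeneousSet H X ∧ ConstituentPathIn (fun i => f i) X

/-- The house: the complement of the five-vertex path. -/
def house : SimpleGraph (Fin 5) := (SimpleGraph.pathGraph 5)ᶜ

def HouseFree (G : SimpleGraph V) : Prop := IsEmpty (house ↪g G)

/-- `g` is a good function on the induced subgraph `G[X]`. -/
def GoodOnSub [Fintype V] (G : SimpleGraph V) (X : Set V) (g : V → ℝ) : Prop :=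
  (∀ v ∈ X, 0 ≤ g v) ∧
  ∀ S : Finset V, (S : Set V) ⊆ X → IsPerfect (G.induce (S : Set V)) →
    ∑ v ∈ S, g v ≤ 1


lemma ConnSet.eq_of_anticomplete {G : SimpleGraph V} {Y Z : Set V} (hZ : ConnSet G Z)
    (hYZ : Y ⊆ Z) (hY : Y.Nonempty) (h : AnticompleteTo G Y (Z \ Y)) : Z = Y := by
  refine Set.Subset.antisymm (fun z hz => ?_) hYZ
  by_contra hzY
  obtain ⟨y, hy⟩ := hY
  obtain ⟨p⟩ := hZ.preconnected ⟨y, hYZ hy⟩ ⟨z, hz⟩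
  obtain ⟨d, -, hd₁, hd₂⟩ := p.exists_boundary_dart {v | (v : V) ∈ Y} hy hzY
  exact h _ hd₁ _ ⟨d.snd.2, hd₂⟩ d.adj

lemma connSet_singleton (G : SimpleGraph V) (x : V) : ConnSet G {x} := by
  have : Nonempty ({x} : Set V) := ⟨⟨x, rfl⟩⟩
  exact ⟨SimpleGraph.Preconnected.of_subsingleton⟩

lemma exists_maximal_connSet [Finite V] (G : SimpleGraph V) {U : Set V} {x : V} (hx : x ∈ U) :
    ∃ Y ⊆ U, x ∈ Y ∧ ConnSet G Y ∧ AnticompleteTo G Y (U \ Y) := by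
  obtain ⟨Y, hxY, hY⟩ := (Set.toFinite {Y : Set V | Y ⊆ U ∧ ConnSet G Y}).exists_le_maximal
    (a := {x}) ⟨Set.singleton_subset_iff.2 hx, connSet_singleton G x⟩
  refine ⟨Y, hY.prop.1, hxY rfl, hY.prop.2, fun y hy z hz hyz => hz.2 ?_⟩
  have hconn : ConnSet G (Y ∪ {z}) :=
    SimpleGraph.connected_induce_union hY.prop.2.preconnected
      (connSet_singleton G z).preconnected hy rfl hyz
  exact hY.le_of_ge ⟨Set.union_subset hY.prop.1 (Set.singleton_subset_iff.2 hz.1), hconn⟩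
    Set.subset_union_left (Or.inr rfl)

lemma setSum_diff_add [Fintype V] (f : V → ℝ) {A B : Set V} (h : A ⊆ B) :
    setSum f (B \ A) + setSum f A = setSum f B := by
  simp only [setSum, ← Finset.sum_add_distrib]
  refine Finset.sum_congr rfl fun v _ => ?_
  have := @h v
  by_cases hA : v ∈ A <;> by_cases hB : v ∈ B <;> simp_all

lemma Coherent.setSum_lt_or [Fintype V] {G : SimpleGraph V} {w : V → ℝ} {ε : ℝ}
    (h : Coherent G w ε) {X U : Set V} (hU : AnticompleteTo G U (X \ U)) :
    setSum w U < ε ∨ setSum w (X \ U) < ε :=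
  min_lt_iff.1 (h.2.2 U (X \ U) Set.disjoint_sdiff_right hU)

theorem statement_9 {V : Type} [Fintype V] (G : SimpleGraph V) (w : V → ℝ) (ε : ℝ)
    (hε : 0 < ε) (hw : IsWeight w) (hcoh : Coherent G w ε)
    (X : Set V) (hX : 3 * ε ≤ setSum w X) :
    ∃ Y : Set V, IsCompOf G X Y ∧ setSum w X - ε < setSum w Y := by
  obtain ⟨U, hU⟩ := (Set.toFinite {U : Set V | U ⊆ X ∧ AnticompleteTo G U (X \ U) ∧
      setSum w (X \ U) < ε}).exists_minimal
    ⟨X, subset_rfl, by simp [AnticompleteTo], by simpa [setSum] using hε⟩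
  obtain ⟨hUX, hUanti, hUlt⟩ := hU.prop
  have hUsum := setSum_diff_add w hUX
  have hUne : U.Nonempty := by
    by_contra hne
    rw [Set.not_nonempty_iff_eq_empty] at hne
    subst hne
    have : setSum w ∅ = 0 := by simp [setSum]
    linarith
  obtain ⟨x, hx⟩ := hUne
  obtain ⟨Y, hYU, hxY, hYconn, hYanti⟩ := exists_maximal_connSet G hx
  have hYX : AnticompleteTo G Y (X \ Y) := fun y hy z hz hyz => by
    by_cases hzU : z ∈ U
    · exact hYanti y hy z ⟨hzU, hz.2⟩ hyz
    · exact hUanti y (hYU hy) z ⟨hz.1, hzU⟩ hyz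
  have hdiff : AnticompleteTo G (U \ Y) (X \ (U \ Y)) := fun u hu z hz huz => by
    by_cases hzU : z ∈ U
    · exact hYanti z (by_contra fun hzY => hz.2 ⟨hzU, hzY⟩) u hu huz.symm
    · exact hUanti u hu.1 z ⟨hz.1, hzU⟩ huz
  refine ⟨Y, ⟨hYU.trans hUX, hYconn, fun Z hYZ hZX hZ => hZ.eq_of_anticomplete hYZ ⟨x, hxY⟩
    fun y hy z hz => hYX y hy z ⟨hZX hz.1, hz.2⟩⟩, ?_⟩
  have hYsum := setSum_diff_add w hYU
  have hYXsum := setSum_diff_add w (hYU.trans hUX)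
  have hUY : setSum w (U \ Y) < ε := (hcoh.setSum_lt_or hdiff).resolve_right fun hlt =>
    (hU.le_of_le ⟨Set.sdiff_subset.trans hUX, hdiff, hlt⟩ Set.sdiff_subset hx).2 hxY
  rcases hcoh.setSum_lt_or hYX with h | h <;> linarith

end EHhat
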